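/- Under the Tikhonov EKI setup with the regularity assumption on H, define the regularized loss ℓ(u) = (H(u) − z)ᵀ Γ_+^{−1} (H(u) − z). Suppose the EKI mean sequence (m_n) is bounded, the sample covariance satisfies the lower bound C_n^{uu} ⪰ κ_m n^{γ−β−1} I for all n ≥ 1 with κ_m > 0, and ℓ is strongly convex: there is λ_c > 0 with ℓ(x) − ℓ(y) ≥ ⟨∇ℓ(y), x − y⟩ + λ_c‖x − y‖² for all x, y; let u* be the global minimizer of ℓ. Then there exist a threshold n_0 and a constant D such that for all N ≥ n_0: (1) if γ = 0, then for any α < min{(1+β)/2, h_0 κ_m λ_c} one has λ_c ‖m_N − u*‖² ≤ ℓ(m_N) − ℓ(u*) ≤ D N^{−α}; (2) if 0 < γ < 1, then for any α < (1 + β − γ)/2 one has λ_c ‖m_N − u*‖² ≤ ℓ(m_N) − ℓ(u*) ≤ D N^{−α}. -/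

import Mathlib

open scoped BigOperators
open Matrix

noncomputable section

/-- Euclidean norm of a vector `v : Fin d → ℝ`. -/
def evNorm {d : ℕ} (v : Fin d → ℝ) : ℝ := Real.sqrt (∑ i, v i ^ 2)

/-- Spectral (ℓ²-operator) norm of a real matrix. -/
def spNorm {p q : ℕ} (A : Matrix (Fin p) (Fin q) ℝ) : ℝ :=
  sSup {r : ℝ | ∃ v : Fin q → ℝ, evNorm v ≤ 1 ∧ r = evNorm (A.mulVec v)}

/-- Smallest eigenvalue (Rayleigh quotient infimum) of a square matrix. -/
def lambdaMin {d : ℕ} (A : Matrix (Fin d) (Fin d) ℝ) : ℝ :=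
  sInf {r : ℝ | ∃ v : Fin d → ℝ, evNorm v = 1 ∧ r = v ⬝ᵥ A.mulVec v}

/-- Loewner order `A ⪯ B` : `B - A` is positive semidefinite. -/
def loewnerLE {d : ℕ} (A B : Matrix (Fin d) (Fin d) ℝ) : Prop := (B - A).PosSemidef

/-- Sample mean of an ensemble of `K` vectors. -/
def sMean {K d : ℕ} (u : Fin K → Fin d → ℝ) : Fin d → ℝ := (K : ℝ)⁻¹ • ∑ i, u i

/-- Sample (cross-)covariance of two ensembles. -/
def sCov {K p q : ℕ} (a : Fin K → Fin p → ℝ) (b : Fin K → Fin q → ℝ) :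
    Matrix (Fin p) (Fin q) ℝ :=
  (K : ℝ)⁻¹ • ∑ i, Matrix.of (fun j l => (a i j - sMean a j) * (b i l - sMean b l))

/-- Jacobian matrix of a map between finite-dimensional coordinate spaces. -/
def jac {a b : ℕ} (H : (Fin a → ℝ) → Fin b → ℝ) (x : Fin a → ℝ) :
    Matrix (Fin b) (Fin a) ℝ :=
  Matrix.of fun i j => fderiv ℝ H x (Pi.single j 1) i

/-- Gradient (coordinate) vector of a scalar function. -/
def gradVec {d : ℕ} (f : (Fin d → ℝ) → ℝ) (x : Fin d → ℝ) : Fin d → ℝ :=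
  fun j => fderiv ℝ f x (Pi.single j 1)

/-- The augmented (Tikhonov) observation map `u ↦ (G u, u)`. -/
def aug {du dy : ℕ} (G : (Fin du → ℝ) → Fin dy → ℝ) (u : Fin du → ℝ) :
    Fin (dy + du) → ℝ :=
  Fin.append (G u) u

/-- The augmented noise covariance `Γ₊ = blockdiag(Γ, I)`. -/
def gammaPlus {dy du : ℕ} (Γ : Matrix (Fin dy) (Fin dy) ℝ) :
    Matrix (Fin (dy + du)) (Fin (dy + du)) ℝ :=
  Matrix.reindex finSumFinEquiv finSumFinEquiv (Matrix.fromBlocks Γ 0 0 1)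

/-- `C^{uu}`: sample covariance of the ensemble. -/
def Cuu {K du : ℕ} (u : Fin K → Fin du → ℝ) : Matrix (Fin du) (Fin du) ℝ := sCov u u

/-- `C^{up}`: sample cross-covariance of the ensemble and its (augmented) observations. -/
def Cup {K du dy : ℕ} (G : (Fin du → ℝ) → Fin dy → ℝ) (u : Fin K → Fin du → ℝ) :
    Matrix (Fin du) (Fin (dy + du)) ℝ :=
  sCov u (fun i => aug G (u i))

/-- `C^{pp}`: sample covariance of the (augmented) observations. -/
def Cpp {K du dy : ℕ} (G : (Fin du → ℝ) → Fin dy → ℝ) (u : Fin K → Fin du → ℝ) :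
    Matrix (Fin (dy + du)) (Fin (dy + du)) ℝ :=
  sCov (fun i => aug G (u i)) (fun i => aug G (u i))


/-- The Tikhonov-regularized loss `ℓ(u) = (H(u) − z)ᵀ Γ₊⁻¹ (H(u) − z)`. -/
def lossFn {du dy : ℕ} (G : (Fin du → ℝ) → Fin dy → ℝ)
    (Γ : Matrix (Fin dy) (Fin dy) ℝ) (z : Fin (dy + du) → ℝ) (w : Fin du → ℝ) : ℝ :=
  (aug G w - z) ⬝ᵥ ((gammaPlus Γ)⁻¹.mulVec (aug G w - z))


lemma evNorm_eq {d : ℕ} (v : Fin d → ℝ) : evNorm v = ‖WithLp.toLp 2 v‖ := by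
  rw [EuclideanSpace.norm_eq]; simp [evNorm]

lemma evNorm_nonneg {d : ℕ} (v : Fin d → ℝ) : 0 ≤ evNorm v := Real.sqrt_nonneg _

lemma evNorm_sq {d : ℕ} (v : Fin d → ℝ) : evNorm v ^ 2 = v ⬝ᵥ v := by
  unfold evNorm
  rw [Real.sq_sqrt (Finset.sum_nonneg fun i _ => sq_nonneg _)]
  simp [dotProduct, sq]

lemma evNorm_add {d : ℕ} (v w : Fin d → ℝ) : evNorm (v + w) ≤ evNorm v + evNorm w := by
  simp only [evNorm_eq, WithLp.toLp_add]; exact norm_add_le _ _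

lemma evNorm_sub {d : ℕ} (v w : Fin d → ℝ) : evNorm (v - w) ≤ evNorm v + evNorm w := by
  simp only [evNorm_eq, WithLp.toLp_sub]; exact norm_sub_le _ _

lemma evNorm_neg {d : ℕ} (v : Fin d → ℝ) : evNorm (-v) = evNorm v := by
  simp only [evNorm_eq, WithLp.toLp_neg]; exact norm_neg _

lemma evNorm_smul {d : ℕ} (c : ℝ) (v : Fin d → ℝ) : evNorm (c • v) = |c| * evNorm v := by
  simp only [evNorm_eq, WithLp.toLp_smul, norm_smul, Real.norm_eq_abs]

lemma evNorm_zero {d : ℕ} : evNorm (0 : Fin d → ℝ) = 0 := by simp [evNorm]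

lemma abs_dot_le {d : ℕ} (v w : Fin d → ℝ) : |v ⬝ᵥ w| ≤ evNorm v * evNorm w := by
  have h := abs_real_inner_le_norm (WithLp.toLp 2 v) (WithLp.toLp 2 w)
  rw [EuclideanSpace.inner_eq_star_dotProduct] at h
  simp only [evNorm_eq]
  simpa [dotProduct_comm] using h

lemma dot_le {d : ℕ} (v w : Fin d → ℝ) : v ⬝ᵥ w ≤ evNorm v * evNorm w :=
  (le_abs_self _).trans (abs_dot_le v w)

lemma evNorm_avg {K d : ℕ} (x : Fin K → Fin d → ℝ) (b : ℝ) (hb : 0 ≤ b)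
    (h : ∀ i, evNorm (x i) ≤ b) : evNorm ((K : ℝ)⁻¹ • ∑ i, x i) ≤ b := by
  rw [evNorm_smul, abs_of_nonneg (by positivity)]
  have h1 : evNorm (∑ i, x i) ≤ K * b := by
    have : evNorm (∑ i, x i) ≤ ∑ i, evNorm (x i) := by
      simp only [evNorm_eq, WithLp.toLp_sum]; exact norm_sum_le _ _
    refine this.trans ((Finset.sum_le_sum fun i _ => h i).trans ?_)
    simp
  rcases Nat.eq_zero_or_pos K with rfl | hK
  · simpa using hb
  · have : (0:ℝ) < K := by exact_mod_cast hK
    rw [inv_mul_le_iff₀ this]; exact h1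

lemma exists_mulVec_bound {p q : ℕ} (A : Matrix (Fin p) (Fin q) ℝ) :
    ∃ c : ℝ, 0 ≤ c ∧ ∀ v, evNorm (A *ᵥ v) ≤ c * evNorm v := by
  refine ⟨‖(Matrix.toEuclideanLin A).toContinuousLinearMap‖, norm_nonneg _, fun v => ?_⟩
  have := (Matrix.toEuclideanLin A).toContinuousLinearMap.le_opNorm (WithLp.toLp 2 v)
  simpa [evNorm_eq] using this

lemma exists_quad_lower {p : ℕ} (A : Matrix (Fin p) (Fin p) ℝ) (hA : A.PosDef) :
    ∃ c : ℝ, 0 < c ∧ ∀ v, c * evNorm v ^ 2 ≤ v ⬝ᵥ A *ᵥ v := by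
  obtain ⟨c, hc, hcb⟩ := exists_mulVec_bound A⁻¹
  obtain ⟨c', hc', hcb'⟩ := exists_mulVec_bound A
  have hu : IsUnit A.det := (Matrix.isUnit_iff_isUnit_det A).1 hA.isUnit
  have hs : A.IsSymm := by simpa using hA.1
  refine ⟨(c + 1)⁻¹, by positivity, fun v => ?_⟩
  rw [inv_mul_le_iff₀ (by positivity)]
  set x := A⁻¹ *ᵥ v with hx
  have hAx : A *ᵥ x = v := by rw [hx, Matrix.mulVec_mulVec, Matrix.mul_nonsing_inv _ hu, Matrix.one_mulVec]
  have hpos : ∀ w : Fin p → ℝ, 0 ≤ w ⬝ᵥ A *ᵥ w := fun w => by simpa using hA.posSemidef.dotProduct_mulVec_nonneg w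
  have key := hpos ((c+1) • v - x)
  have h1 : x ⬝ᵥ A *ᵥ v = v ⬝ᵥ v := by
    rw [Matrix.dotProduct_mulVec, ← Matrix.mulVec_transpose, hs.eq, hAx]
  have h2 : x ⬝ᵥ v ≤ c * evNorm v ^ 2 := (dot_le _ _).trans (by nlinarith [hcb v, evNorm_nonneg v])
  simp only [Matrix.mulVec_sub, Matrix.mulVec_smul, sub_dotProduct, dotProduct_sub, smul_dotProduct, dotProduct_smul, hAx, h1, smul_eq_mul, ← evNorm_sq] at key
  have : 0 ≤ (c+1) * ((c+1) * (v ⬝ᵥ A *ᵥ v) - evNorm v ^ 2) := by nlinarith [sq_nonneg (evNorm v)]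
  have := nonneg_of_mul_nonneg_right this (by positivity)
  linarith

lemma gammaPlus_posDef {dy du : ℕ} (Γ : Matrix (Fin dy) (Fin dy) ℝ) (hΓ : Γ.PosDef) :
    (gammaPlus (du := du) Γ).PosDef := by
  unfold gammaPlus
  rw [Matrix.reindex_apply]
  have : (Matrix.fromBlocks Γ 0 0 (1 : Matrix (Fin du) (Fin du) ℝ)).PosDef := by
    refine Matrix.PosDef.of_dotProduct_mulVec_pos ?_ ?_
    · exact Matrix.IsHermitian.fromBlocks hΓ.1 (by simp) Matrix.isHermitian_one
    · intro x hx
      have e : x = Sum.elim (x ∘ Sum.inl) (x ∘ Sum.inr) := by simp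
      rw [e, Matrix.fromBlocks_mulVec]
      simp only [star_trivial, Matrix.zero_mulVec, add_zero, zero_add, Sum.elim_comp_inl, Sum.elim_comp_inr, Matrix.one_mulVec]
      rw [sumElim_dotProduct_sumElim]
      by_cases h : x ∘ Sum.inl = 0
      · have h' : x ∘ Sum.inr ≠ 0 := by
          intro h'; apply hx; rw [e, h, h']; ext i; cases i <;> simp
        have := (Matrix.PosDef.one (n := Fin du) (R := ℝ)).dotProduct_mulVec_pos h'
        rw [h]; simpa using this
      · have h1 := hΓ.dotProduct_mulVec_pos h
        have h2 : 0 ≤ (x ∘ Sum.inr) ⬝ᵥ (x ∘ Sum.inr) := by rw [← evNorm_sq]; positivity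
        simp only [star_trivial] at h1
        linarith
  exact this.submatrix finSumFinEquiv.symm.injective

lemma gammaPlus_quad {dy du : ℕ} (Γ : Matrix (Fin dy) (Fin dy) ℝ) (w : Fin du → ℝ) :
    (Fin.append (0 : Fin dy → ℝ) w) ⬝ᵥ gammaPlus (du := du) Γ *ᵥ (Fin.append 0 w) = w ⬝ᵥ w := by
  have e : Fin.append (0 : Fin dy → ℝ) w = Sum.elim (0 : Fin dy → ℝ) w ∘ finSumFinEquiv.symm := by
    ext i; refine Fin.addCases (fun i => ?_) (fun i => ?_) i <;> simp
  unfold gammaPlus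
  rw [Matrix.reindex_apply, e, Matrix.submatrix_mulVec_equiv]
  simp [Function.comp_assoc, Matrix.fromBlocks_mulVec, dotProduct_comp_equiv_symm]

lemma append_dot {dy du : ℕ} (x : Fin (dy+du) → ℝ) (w : Fin du → ℝ) :
    x ⬝ᵥ (Fin.append (0 : Fin dy → ℝ) w) = (fun i => x (Fin.natAdd dy i)) ⬝ᵥ w := by
  simp [dotProduct, Fin.sum_univ_add]

lemma rpow_succ_lower (α : ℝ) (hα : 0 ≤ α) (n : ℕ) (hn : 1 ≤ n) :
    (n : ℝ) ^ (-α) * (1 - α / n) ≤ ((n + 1 : ℕ) : ℝ) ^ (-α) := by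
  have hn' : (0:ℝ) < n := by exact_mod_cast hn
  have e : ((n + 1 : ℕ) : ℝ) = n * (1 + 1 / n) := by push_cast; field_simp
  rw [e, Real.mul_rpow hn'.le (by positivity)]
  apply mul_le_mul_of_nonneg_left _ (by positivity)
  have h1 : (1 : ℝ) + 1 / n ≤ Real.exp (1 / n) := by linarith [Real.add_one_le_exp (1 / (n:ℝ))]
  have h2 : (1 + 1 / (n:ℝ)) ^ α ≤ Real.exp (α / n) := by
    calc (1 + 1 / (n:ℝ)) ^ α ≤ (Real.exp (1 / n)) ^ α := Real.rpow_le_rpow (by positivity) h1 hα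
      _ = Real.exp (α / n) := by rw [← Real.exp_mul]; congr 1; ring
  rw [Real.rpow_neg (by positivity)]
  calc 1 - α / n ≤ Real.exp (-(α / n)) := by linarith [Real.add_one_le_exp (-(α / (n:ℝ)))]
    _ = (Real.exp (α / n))⁻¹ := Real.exp_neg _
    _ ≤ _ := inv_anti₀ (by positivity) h2

lemma rpow_succ_lower' (s : ℝ) (hs : s ≤ 1) (n : ℕ) (hn : 1 ≤ n) :
    (n : ℝ) ^ (-s) * (n / (n + 1)) ≤ ((n + 1 : ℕ) : ℝ) ^ (-s) := by
  have hn' : (0:ℝ) < n := by exact_mod_cast hn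
  have e : ((n + 1 : ℕ) : ℝ) = n * ((n + 1) / n) := by push_cast; field_simp
  rw [e, Real.mul_rpow hn'.le (by positivity)]
  apply mul_le_mul_of_nonneg_left _ (by positivity)
  have h1 : (1:ℝ) ≤ (n + 1) / n := by rw [le_div_iff₀ hn']; linarith
  calc (n / (n + 1) : ℝ) = ((n + 1) / n : ℝ) ^ (-1 : ℝ) := by rw [Real.rpow_neg_one, inv_div]
    _ ≤ _ := Real.rpow_le_rpow_of_exponent_le h1 (by linarith)

lemma cov_scalar (y a q n : ℝ) (hn : 1 ≤ n) (hq0 : 1 / n ≤ q) (hq1 : q ≤ 1) (ha : 0 ≤ a)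
    (hy : 1 + 4 * a ≤ y) : y / (1 + y * q) + a * q ≤ y * (n / (n + 1)) := by
  have hn0 : 0 < n := by linarith
  have hq : 0 < q := lt_of_lt_of_le (by positivity) hq0
  have hy0 : 0 < y := by linarith
  have h1 : 1 / (1 + q) ≤ n / (n + 1) := by
    rw [div_le_div_iff₀ (by positivity) (by positivity)]
    rw [div_le_iff₀ hn0] at hq0; nlinarith
  have h2 : y / (1 + y * q) + a * q ≤ y * (1 / (1 + q)) := by
    rw [mul_one_div, ← sub_nonneg]
    have : y / (1 + q) - (y / (1 + y * q) + a * q) =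
      q * (y * (y - 1) - a * (1 + q) * (1 + y * q)) / ((1 + q) * (1 + y * q)) := by
      field_simp; ring
    rw [this]
    apply div_nonneg _ (by positivity)
    apply mul_nonneg hq.le
    have h3 : (1 + q) * (1 + y * q) ≤ 2 * (1 + y) := by
      apply mul_le_mul <;> nlinarith [mul_pos hy0 hq]
    have : a * ((1 + q) * (1 + y * q)) ≤ a * (2 * (1 + y)) := mul_le_mul_of_nonneg_left h3 ha
    nlinarith
  exact h2.trans (mul_le_mul_of_nonneg_left h1 hy0.le)

lemma cov_upper {d : ℕ} (C : ℕ → Matrix (Fin d) (Fin d) ℝ) (h₀ α₀ γ β : ℝ) (hh₀ : 0 < h₀)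
    (hγ0 : 0 ≤ γ) (hγ1 : γ ≤ 1) (hβu : β ≤ γ)
    (c₁ : ℝ) (hc₁ : ∀ v, v ⬝ᵥ C 1 *ᵥ v ≤ c₁ * evNorm v ^ 2)
    (hstep : ∀ n : ℕ, 1 ≤ n → ∀ v, ∀ t : ℝ, v ⬝ᵥ C (n + 1) *ᵥ v ≤
      (1 - t) ^ 2 * (v ⬝ᵥ C n *ᵥ v) + t ^ 2 * (h₀ * (n:ℝ) ^ β)⁻¹ * evNorm v ^ 2 +
        (α₀ ^ 2 * h₀⁻¹ * (n:ℝ) ^ (2 * γ - β - 2)) * evNorm v ^ 2) :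
    ∃ A : ℝ, 0 < A ∧ ∀ n : ℕ, 1 ≤ n → ∀ v,
      v ⬝ᵥ C n *ᵥ v ≤ A * (n:ℝ) ^ (-(1 + β - γ)) * evNorm v ^ 2 := by
  set A := max c₁ ((1 + 4 * α₀ ^ 2) / h₀) with hA
  have hA0 : 0 < A := lt_of_lt_of_le (by positivity) (le_max_right _ _)
  refine ⟨A, hA0, fun n hn => ?_⟩
  induction n, hn using Nat.le_induction with
  | base =>
    intro v
    refine (hc₁ v).trans ?_
    simp only [Nat.cast_one, Real.one_rpow, mul_one]
    exact mul_le_mul_of_nonneg_right (le_max_left _ _) (by positivity)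
  | succ n hn ih =>
    intro v
    have hn1 : (1:ℝ) ≤ n := by exact_mod_cast hn
    have hn0 : (0:ℝ) < n := by linarith
    set q := (n:ℝ) ^ (γ - 1) with hq
    have hqpos : 0 < q := by positivity
    set X := (n:ℝ) ^ (-(1 + β - γ)) with hX
    have hXpos : 0 < X := by positivity
    have hBX : (n:ℝ) ^ β * X = q := by
      rw [hX, ← Real.rpow_add hn0]; congr 1; ring
    have hXq : (n:ℝ) ^ (2 * γ - β - 2) = X * q := by
      rw [hX, hq, ← Real.rpow_add hn0]; congr 1; ring
    have hq1 : q ≤ 1 := Real.rpow_le_one_of_one_le_of_nonpos hn1 (by linarith)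
    have hq0 : 1 / n ≤ q := by
      rw [one_div, ← Real.rpow_neg_one]
      exact Real.rpow_le_rpow_of_exponent_le hn1 (by linarith)
    have hy : 1 + 4 * α₀ ^ 2 ≤ h₀ * A := by
      have := le_max_right c₁ ((1 + 4 * α₀ ^ 2) / h₀)
      rw [div_le_iff₀ hh₀] at this; linarith
    have hs := cov_scalar (h₀ * A) (α₀ ^ 2) q n hn1 hq0 hq1 (by positivity) hy
    have hr := rpow_succ_lower' (1 + β - γ) (by linarith) n hn
    set t := h₀ * A * q / (1 + h₀ * A * q) with ht
    have h1 := hstep n hn v t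
    have h2 := ih v
    have hb : 0 < (n:ℝ) ^ β := by positivity
    have hbe : (n:ℝ) ^ β = q / X := by rw [← hBX]; field_simp
    have h3 : (1 - t) ^ 2 * (A * X) + t ^ 2 * (h₀ * (n:ℝ) ^ β)⁻¹ = X * (A / (1 + h₀ * A * q)) := by
      rw [ht, hbe]; field_simp; ring
    have h4 : A / (1 + h₀ * A * q) + α₀ ^ 2 * h₀⁻¹ * q ≤ A * (n / (n + 1)) := by
      have : h₀ * (A / (1 + h₀ * A * q) + α₀ ^ 2 * h₀⁻¹ * q) ≤ h₀ * (A * (n / (n + 1))) := by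
        convert hs using 1 <;> field_simp
      exact le_of_mul_le_mul_left this hh₀
    rw [hXq] at h1
    have h5 : (1 - t) ^ 2 * (v ⬝ᵥ C n *ᵥ v) ≤ (1 - t) ^ 2 * (A * X * evNorm v ^ 2) :=
      mul_le_mul_of_nonneg_left h2 (by positivity)
    calc v ⬝ᵥ C (n + 1) *ᵥ v ≤ ((1 - t) ^ 2 * (A * X) + t ^ 2 * (h₀ * (n:ℝ) ^ β)⁻¹ + α₀ ^ 2 * h₀⁻¹ * (X * q)) * evNorm v ^ 2 := by linarith
      _ = (X * (A / (1 + h₀ * A * q) + α₀ ^ 2 * h₀⁻¹ * q)) * evNorm v ^ 2 := by rw [h3]; ring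
      _ ≤ (X * (A * (n / (n + 1)))) * evNorm v ^ 2 := by gcongr
      _ = (A * (X * (n / (n + 1)))) * evNorm v ^ 2 := by ring
      _ ≤ _ := by gcongr

lemma rec_bound (a : ℕ → ℝ) (p p' C γ s α : ℝ) (hC : 0 ≤ C) (hp' : 0 < p')
    (hα : 0 ≤ α) (hαs : α ≤ s) (n₀ : ℕ) (hn₀ : 1 ≤ n₀)
    (h1 : ∀ n : ℕ, n₀ ≤ n → 0 ≤ 1 - p * (n:ℝ) ^ (γ - 1))
    (h2 : ∀ n : ℕ, n₀ ≤ n → p' * (n:ℝ) ^ (γ - 1) ≤ p * (n:ℝ) ^ (γ - 1) - α / n)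
    (hrec : ∀ n : ℕ, n₀ ≤ n → a (n + 1) ≤
      (1 - p * (n:ℝ) ^ (γ - 1)) * a n + C * (n:ℝ) ^ (γ - 1) * (n:ℝ) ^ (-s)) :
    ∃ D : ℝ, 0 ≤ D ∧ ∀ N : ℕ, n₀ ≤ N → a N ≤ D * (N:ℝ) ^ (-α) := by
  refine ⟨max (a n₀ * (n₀:ℝ) ^ α) (C / p'), le_max_of_le_right (by positivity), fun N hN => ?_⟩
  set D := max (a n₀ * (n₀:ℝ) ^ α) (C / p') with hD
  induction N, hN using Nat.le_induction with
  | base =>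
    have hn : (0:ℝ) < n₀ := by exact_mod_cast hn₀
    calc a n₀ = (a n₀ * (n₀:ℝ) ^ α) * (n₀:ℝ) ^ (-α) := by
          rw [mul_assoc, ← Real.rpow_add hn]; simp
      _ ≤ _ := mul_le_mul_of_nonneg_right (le_max_left _ _) (by positivity)
  | succ n hn ih =>
    have hnn : 1 ≤ n := hn₀.trans hn
    have hn1 : (1:ℝ) ≤ n := by exact_mod_cast hnn
    have hn0 : (0:ℝ) < n := by linarith
    have hr := rpow_succ_lower α hα n hnn
    have hCD : C ≤ p' * D := by
      have := le_max_right (a n₀ * (n₀:ℝ) ^ α) (C / p')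
      rw [div_le_iff₀ hp'] at this; linarith
    have hD0 : 0 ≤ D := le_max_of_le_right (by positivity)
    have hsα : (n:ℝ) ^ (-s) ≤ (n:ℝ) ^ (-α) := Real.rpow_le_rpow_of_exponent_le hn1 (by linarith)
    have e1 := h1 n hn
    have e2 := h2 n hn
    have e3 := hrec n hn
    set q := (n:ℝ) ^ (γ - 1) with hq
    have hqpos : 0 < q := by positivity
    set Y := (n:ℝ) ^ (-α)
    have hY : 0 < Y := by positivity
    have f1 : (1 - p * q) * a n ≤ (1 - p * q) * (D * Y) := mul_le_mul_of_nonneg_left ih e1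
    have f2 : C * q * (n:ℝ) ^ (-s) ≤ p' * D * q * Y := by gcongr
    have f3 : D * (Y * (1 - α / n)) ≤ D * ((n + 1 : ℕ) : ℝ) ^ (-α) := by gcongr
    have f4 : 0 ≤ D * Y * (p * q - α / n - p' * q) := mul_nonneg (by positivity) (by linarith)
    nlinarith

lemma sCov_mulVec {K p q : ℕ} (a : Fin K → Fin p → ℝ) (b : Fin K → Fin q → ℝ) (w : Fin q → ℝ) :
    sCov a b *ᵥ w = (K : ℝ)⁻¹ • ∑ i, ((b i - sMean b) ⬝ᵥ w) • (a i - sMean a) := by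
  unfold sCov
  rw [Matrix.smul_mulVec, Matrix.sum_mulVec]
  congr 1
  refine Finset.sum_congr rfl fun i _ => ?_
  ext j
  simp only [Matrix.mulVec, dotProduct, Matrix.of_apply, Pi.smul_apply, Pi.sub_apply, smul_eq_mul, Finset.sum_mul]
  refine Finset.sum_congr rfl fun l _ => by ring

lemma sCov_transpose {K p q : ℕ} (a : Fin K → Fin p → ℝ) (b : Fin K → Fin q → ℝ) :
    (sCov a b)ᵀ = sCov b a := by
  unfold sCov
  rw [Matrix.transpose_smul, Matrix.transpose_sum]
  congr 1
  refine Finset.sum_congr rfl fun i _ => ?_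
  ext j l
  simp [mul_comm]

lemma sCov_quad {K p q : ℕ} (a : Fin K → Fin p → ℝ) (b : Fin K → Fin q → ℝ) (v : Fin p → ℝ)
    (w : Fin q → ℝ) :
    v ⬝ᵥ sCov a b *ᵥ w =
      (K : ℝ)⁻¹ * ∑ i, ((a i - sMean a) ⬝ᵥ v) * ((b i - sMean b) ⬝ᵥ w) := by
  rw [sCov_mulVec, dotProduct_smul, dotProduct_sum, smul_eq_mul]
  congr 1
  refine Finset.sum_congr rfl fun i _ => ?_
  rw [dotProduct_smul, smul_eq_mul, dotProduct_comm v, mul_comm]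

lemma sCov_nonneg {K p : ℕ} (a : Fin K → Fin p → ℝ) (v : Fin p → ℝ) :
    0 ≤ v ⬝ᵥ sCov a a *ᵥ v := by
  rw [sCov_quad]
  exact mul_nonneg (by positivity) (Finset.sum_nonneg fun i _ => mul_self_nonneg _)

lemma sCov_upper {K p : ℕ} (a : Fin K → Fin p → ℝ) :
    ∃ c : ℝ, ∀ v, v ⬝ᵥ sCov a a *ᵥ v ≤ c * evNorm v ^ 2 := by
  obtain ⟨c, hc, h⟩ := exists_mulVec_bound (sCov a a)
  refine ⟨c, fun v => (dot_le _ _).trans ?_⟩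
  nlinarith [h v, evNorm_nonneg v]

lemma dev_bound {K p : ℕ} (a : Fin K → Fin p → ℝ) (c : ℝ) (hc : 0 ≤ c)
    (h : ∀ v, v ⬝ᵥ sCov a a *ᵥ v ≤ c * evNorm v ^ 2) (i : Fin K) :
    evNorm (a i - sMean a) ≤ Real.sqrt (K * c) := by
  have hK : (0:ℝ) < K := by exact_mod_cast (Fin.pos i)
  apply Real.le_sqrt_of_sq_le
  set d := a i - sMean a with hd
  have h1 := h d
  rw [sCov_quad, inv_mul_le_iff₀ hK] at h1
  have h2 : (d ⬝ᵥ d) * (d ⬝ᵥ d) ≤ ∑ j, ((a j - sMean a) ⬝ᵥ d) * ((a j - sMean a) ⬝ᵥ d) :=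
    Finset.single_le_sum (f := fun j => ((a j - sMean a) ⬝ᵥ d) * ((a j - sMean a) ⬝ᵥ d))
      (fun j _ => mul_self_nonneg _) (Finset.mem_univ i)
  rw [← evNorm_sq] at h2
  rcases (sq_nonneg (evNorm d)).eq_or_lt with h0 | h0
  · rw [← h0]; positivity
  · have : evNorm d ^ 2 * evNorm d ^ 2 ≤ (K * c) * evNorm d ^ 2 := by linarith
    exact le_of_mul_le_mul_right this h0

section Sfacts
variable {K du dy : ℕ}

lemma S_posDef (G : (Fin du → ℝ) → Fin dy → ℝ) (Γ : Matrix (Fin dy) (Fin dy) ℝ) (hΓ : Γ.PosDef)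
    (U : Fin K → Fin du → ℝ) (t : ℝ) (ht : 0 < t) : (Cpp G U + t • gammaPlus Γ).PosDef := by
  refine Matrix.PosDef.posSemidef_add ?_ ((gammaPlus_posDef Γ hΓ).smul ht)
  refine Matrix.PosSemidef.of_dotProduct_mulVec_nonneg ?_ ?_
  · unfold Cpp
    rw [Matrix.IsHermitian, Matrix.conjTranspose_eq_transpose_of_trivial, sCov_transpose]
  · intro x
    simpa [Cpp] using sCov_nonneg (fun i => aug G (U i)) x

lemma sMean_aug (G : (Fin du → ℝ) → Fin dy → ℝ) (U : Fin K → Fin du → ℝ) (j : Fin du) :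
    sMean (fun i => aug G (U i)) (Fin.natAdd dy j) = sMean U j := by
  simp [sMean, aug]

lemma cov_step_quad (G : (Fin du → ℝ) → Fin dy → ℝ) (Γ : Matrix (Fin dy) (Fin dy) ℝ)
    (hΓ : Γ.PosDef) (U : Fin K → Fin du → ℝ) (s : ℝ) (hs : 0 < s) (v : Fin du → ℝ) (t : ℝ) :
    v ⬝ᵥ (Cuu U - Cup G U * (Cpp G U + s • gammaPlus Γ)⁻¹ * (Cup G U)ᵀ) *ᵥ v ≤
      (1 - t) ^ 2 * (v ⬝ᵥ Cuu U *ᵥ v) + t ^ 2 * s * evNorm v ^ 2 := by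
  have hS := S_posDef G Γ hΓ U s hs
  set S := Cpp G U + s • gammaPlus Γ with hSdef
  have hu : IsUnit S.det := (Matrix.isUnit_iff_isUnit_det S).1 hS.isUnit
  have hsym : S.IsSymm := by simpa using hS.1
  set b := (Cup G U)ᵀ *ᵥ v with hb
  set x := S⁻¹ *ᵥ b with hx
  have hSx : S *ᵥ x = b := by
    rw [hx, Matrix.mulVec_mulVec, Matrix.mul_nonsing_inv _ hu, Matrix.one_mulVec]
  set w : Fin (dy + du) → ℝ := Fin.append 0 (t • v) with hw
  have hpos : 0 ≤ (x - w) ⬝ᵥ S *ᵥ (x - w) := by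
    simpa using hS.posSemidef.dotProduct_mulVec_nonneg (x - w)
  have h1 : x ⬝ᵥ S *ᵥ w = w ⬝ᵥ b := by
    rw [Matrix.dotProduct_mulVec, ← Matrix.mulVec_transpose, hsym.eq, hSx, dotProduct_comm]
  rw [Matrix.mulVec_sub, sub_dotProduct, dotProduct_sub, dotProduct_sub, hSx, h1] at hpos
  have hdev : ∀ i, (aug G (U i) - sMean fun i => aug G (U i)) ⬝ᵥ w = t * ((U i - sMean U) ⬝ᵥ v) := by
    intro i
    rw [hw, append_dot, dotProduct_smul, smul_eq_mul]
    congr 2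
    ext j
    simp only [Pi.sub_apply, sMean_aug]
    simp [aug]
  have h2 : w ⬝ᵥ b = t * (v ⬝ᵥ Cuu U *ᵥ v) := by
    rw [hb, Cup, sCov_transpose, sCov_quad, Cuu, sCov_quad]
    simp only [hdev, Finset.mul_sum]
    exact Finset.sum_congr rfl fun i _ => by ring
  have h3 : w ⬝ᵥ S *ᵥ w = t ^ 2 * (v ⬝ᵥ Cuu U *ᵥ v) + t ^ 2 * s * evNorm v ^ 2 := by
    rw [hSdef, Matrix.add_mulVec, dotProduct_add, Cpp, sCov_quad, Cuu, sCov_quad,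
      Matrix.smul_mulVec, dotProduct_smul, hw, gammaPlus_quad, ← hw, evNorm_sq]
    simp only [hdev, Finset.mul_sum, smul_dotProduct, dotProduct_smul, smul_eq_mul]
    congr 1
    · exact Finset.sum_congr rfl fun i _ => by ring
    · ring
  have h4 : v ⬝ᵥ (Cuu U - Cup G U * S⁻¹ * (Cup G U)ᵀ) *ᵥ v = v ⬝ᵥ Cuu U *ᵥ v - x ⬝ᵥ b := by
    rw [Matrix.sub_mulVec, dotProduct_sub, ← Matrix.mulVec_mulVec, ← Matrix.mulVec_mulVec, ← hb, ← hx,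
      Matrix.dotProduct_mulVec v (Cup G U), ← Matrix.mulVec_transpose, ← hb, dotProduct_comm x]
  rw [h4]
  rw [h2, h3] at hpos
  nlinarith

end Sfacts

section meanstep
variable {K du dy : ℕ}

lemma sMean_shift {p : ℕ} (b : Fin K → Fin p → ℝ) (c : Fin p → ℝ) (hK : (K:ℝ) ≠ 0) :
    sMean b = c + (K:ℝ)⁻¹ • ∑ j, (b j - c) := by
  unfold sMean
  ext l
  simp only [Pi.smul_apply, Pi.add_apply, Finset.sum_apply, Pi.sub_apply, smul_eq_mul, Finset.sum_sub_distrib, Finset.sum_const, Finset.card_univ, Fintype.card_fin, nsmul_eq_mul, Pi.mul_apply, Pi.natCast_apply]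
  field_simp
  ring

lemma sum_dev {p : ℕ} (b : Fin K → Fin p → ℝ) : ∑ j, (b j - sMean b) = 0 := by
  rcases Nat.eq_zero_or_pos K with rfl | hK
  · simp
  · have hK' : (K:ℝ) ≠ 0 := by positivity
    have := sMean_shift b (sMean b) hK'
    have h2 : (K:ℝ)⁻¹ • ∑ j, (b j - sMean b) = 0 := by
      simpa using this
    simpa [hK.ne'] using h2

lemma sCov_mulVec_bound {p q : ℕ} (a : Fin K → Fin p → ℝ) (b : Fin K → Fin q → ℝ) (w : Fin q → ℝ)
    (ρ σ : ℝ) (hσ : 0 ≤ σ) (hρ0 : 0 ≤ ρ) (hρ : ∀ i, evNorm (a i - sMean a) ≤ ρ)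
    (hb : ∀ i, |(b i - sMean b) ⬝ᵥ w| ≤ σ) : evNorm (sCov a b *ᵥ w) ≤ σ * ρ := by
  rw [sCov_mulVec]
  refine evNorm_avg _ _ (by positivity) fun i => ?_
  rw [evNorm_smul]
  exact mul_le_mul (hb i) (hρ i) (evNorm_nonneg _) hσ

lemma mean_step (G : (Fin du → ℝ) → Fin dy → ℝ) (M₁ M₂ : ℝ) (hM₁ : 0 < M₁) (hM₂ : 0 < M₂)
    (hLip : ∀ x x', evNorm (aug G x - aug G x') ≤ M₁ * evNorm (x - x'))
    (hTay : ∀ x x',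
      evNorm (aug G x' - aug G x - (jac (aug G) x).mulVec (x' - x)) ≤ M₂ * evNorm (x' - x) ^ 2)
    (Γ : Matrix (Fin dy) (Fin dy) ℝ) (hΓ : Γ.PosDef) (γ₀ : ℝ) (hγ₀ : 0 < γ₀)
    (hγ : ∀ v, γ₀ * evNorm v ^ 2 ≤ v ⬝ᵥ gammaPlus (du := du) Γ *ᵥ v)
    (U : Fin K → Fin du → ℝ) (h ρ : ℝ) (hh : 0 < h) (hρ0 : 0 ≤ ρ)
    (hρ : ∀ i, evNorm (U i - sMean U) ≤ ρ) (z r w : Fin (dy + du) → ℝ) (g : Fin du → ℝ)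
    (hr : r = aug G (sMean U) - z) (hw : w = (gammaPlus Γ)⁻¹ *ᵥ r)
    (hg : g = w ᵥ* jac (aug G) (sMean U)) :
    evNorm (Cuu U *ᵥ g) ≤ ρ ^ 2 * evNorm g ∧
    ∃ e, (Cup G U * (Cpp G U + h⁻¹ • gammaPlus Γ)⁻¹) *ᵥ (z - aug G (sMean U)) =
      -(h • Cuu U *ᵥ g) + e ∧
      evNorm e ≤ h * (2 * M₂ * ρ ^ 3 * evNorm w) +
        h * (2 * M₁ * ρ ^ 2 * (h / γ₀) * (2 * M₁ * ρ * (ρ * evNorm g + 2 * M₂ * ρ ^ 2 * evNorm w))) := by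
  set m := sMean U with hm
  set J := jac (aug G) m with hJ
  set P : Fin K → Fin (dy + du) → ℝ := fun i => aug G (U i) with hP
  set R : Fin K → Fin (dy + du) → ℝ := fun i => aug G (U i) - aug G m - J *ᵥ (U i - m) with hR
  set Rb : Fin (dy + du) → ℝ := (K:ℝ)⁻¹ • ∑ j, R j with hRb
  have hRi : ∀ i, evNorm (R i) ≤ M₂ * ρ ^ 2 := fun i => (hTay m (U i)).trans <| by
    have := evNorm_nonneg (U i - m); have := hρ i; gcongr
  have hRbb : evNorm Rb ≤ M₂ * ρ ^ 2 := evNorm_avg _ _ (by positivity) hRi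
  have hdec : ∀ i, P i - sMean P = J *ᵥ (U i - m) + (R i - Rb) := by
    intro i
    have hK : (K:ℝ) ≠ 0 := by have := Fin.pos i; positivity
    have h1 : Rb = (K:ℝ)⁻¹ • ∑ j, (P j - aug G m) := by
      rw [hRb, hR, Finset.sum_sub_distrib, ← Matrix.mulVec_sum, hm, sum_dev]
      simp [hP]
    rw [sMean_shift P (aug G m) hK, ← h1]
    simp only [hP, hR]
    abel
  have hPb : ∀ i, evNorm (P i - sMean P) ≤ 2 * M₁ * ρ := by
    intro i
    have hK : (K:ℝ) ≠ 0 := by have := Fin.pos i; positivity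
    have hl : ∀ j, evNorm (P j - aug G m) ≤ M₁ * ρ := fun j => (hLip _ _).trans (by
      have := hρ j; gcongr)
    have h2 := evNorm_avg _ (M₁ * ρ) (by positivity) hl
    rw [sMean_shift P (aug G m) hK, ← sub_sub]
    exact (evNorm_sub _ _).trans (by linarith [hl i])
  have hPw : ∀ i, (P i - sMean P) ⬝ᵥ w = (U i - m) ⬝ᵥ g + (R i - Rb) ⬝ᵥ w := by
    intro i
    rw [hdec i, add_dotProduct, hg, dotProduct_comm _ w, Matrix.dotProduct_mulVec, dotProduct_comm (U i - m)]
  have hRw : ∀ i, |(R i - Rb) ⬝ᵥ w| ≤ 2 * M₂ * ρ ^ 2 * evNorm w := fun i =>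
    (abs_dot_le _ _).trans (mul_le_mul_of_nonneg_right
      ((evNorm_sub _ _).trans (by linarith [hRi i])) (evNorm_nonneg _))
  have hng := evNorm_nonneg g
  have hnw := evNorm_nonneg w
  have hUg : ∀ i, |(U i - m) ⬝ᵥ g| ≤ ρ * evNorm g := fun i =>
    (abs_dot_le _ _).trans (mul_le_mul_of_nonneg_right (hρ i) hng)
  constructor
  · refine (sCov_mulVec_bound U U g ρ (ρ * evNorm g) (by positivity) hρ0 hρ hUg).trans (by nlinarith)
  have hS := S_posDef G Γ hΓ U h⁻¹ (by positivity)
  set S := Cpp G U + h⁻¹ • gammaPlus Γ with hSdef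
  have hu : IsUnit S.det := (Matrix.isUnit_iff_isUnit_det S).1 hS.isUnit
  have hΓp := gammaPlus_posDef (du := du) Γ hΓ
  have huΓ : IsUnit (gammaPlus (du := du) Γ).det := (Matrix.isUnit_iff_isUnit_det _).1 hΓp.isUnit
  have hΓw : gammaPlus Γ *ᵥ w = r := by
    rw [hw, Matrix.mulVec_mulVec, Matrix.mul_nonsing_inv _ huΓ, Matrix.one_mulVec]
  -- inverse bound
  have hSinv : ∀ x, evNorm (S⁻¹ *ᵥ x) ≤ (h / γ₀) * evNorm x := by
    intro x
    set y := S⁻¹ *ᵥ x with hy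
    have hSy : S *ᵥ y = x := by
      rw [hy, Matrix.mulVec_mulVec, Matrix.mul_nonsing_inv _ hu, Matrix.one_mulVec]
    have h1 : γ₀ / h * evNorm y ^ 2 ≤ evNorm y * evNorm x := by
      refine le_trans ?_ (dot_le y x)
      rw [← hSy, hSdef, Matrix.add_mulVec, dotProduct_add, Matrix.smul_mulVec, dotProduct_smul, smul_eq_mul]
      have := sCov_nonneg P y
      have h3 : h⁻¹ * (γ₀ * evNorm y ^ 2) ≤ h⁻¹ * (y ⬝ᵥ gammaPlus Γ *ᵥ y) := by
        have := hγ y; gcongr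
      have : 0 ≤ y ⬝ᵥ Cpp G U *ᵥ y := this
      calc _ = h⁻¹ * (γ₀ * evNorm y ^ 2) := by ring
        _ ≤ _ := by linarith
    rcases (evNorm_nonneg y).eq_or_lt with h0 | h0
    · rw [← h0]; have := evNorm_nonneg x; positivity
    · have : γ₀ / h * evNorm y ≤ evNorm x := by
        apply le_of_mul_le_mul_left _ h0; nlinarith
      calc evNorm y = (h / γ₀) * (γ₀ / h * evNorm y) := by field_simp
        _ ≤ _ := by gcongr
  have hup : ∀ y, evNorm (Cup G U *ᵥ y) ≤ 2 * M₁ * ρ ^ 2 * evNorm y := by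
    intro y
    have hny := evNorm_nonneg y
    refine (sCov_mulVec_bound U P y ρ (2 * M₁ * ρ * evNorm y) (by positivity) hρ0 hρ fun i =>
      (abs_dot_le _ _).trans (mul_le_mul_of_nonneg_right (hPb i) hny)).trans (by nlinarith)
  have hpp : evNorm (Cpp G U *ᵥ w) ≤ 2 * M₁ * ρ * (ρ * evNorm g + 2 * M₂ * ρ ^ 2 * evNorm w) := by
    refine (sCov_mulVec_bound P P w (2 * M₁ * ρ) (ρ * evNorm g + 2 * M₂ * ρ ^ 2 * evNorm w)
      (by positivity) (by positivity) hPb fun i => ?_).trans (by nlinarith)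
    rw [hPw]
    exact (abs_add_le _ _).trans (add_le_add (hUg i) (hRw i))
  set e₁ : Fin du → ℝ := (K:ℝ)⁻¹ • ∑ i, ((R i - Rb) ⬝ᵥ w) • (U i - m) with he₁
  have he₁b : evNorm e₁ ≤ 2 * M₂ * ρ ^ 3 * evNorm w := by
    refine evNorm_avg _ _ (by positivity) fun i => ?_
    rw [evNorm_smul]
    calc _ ≤ (2 * M₂ * ρ ^ 2 * evNorm w) * ρ := mul_le_mul (hRw i) (hρ i) (evNorm_nonneg _) (by positivity)
      _ = _ := by ring
  have hupw : Cup G U *ᵥ w = Cuu U *ᵥ g + e₁ := by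
    have e1 : Cup G U *ᵥ w = (K:ℝ)⁻¹ • ∑ i, ((P i - sMean P) ⬝ᵥ w) • (U i - m) := sCov_mulVec U P w
    have e2 : Cuu U *ᵥ g = (K:ℝ)⁻¹ • ∑ i, ((U i - m) ⬝ᵥ g) • (U i - m) := sCov_mulVec U U g
    rw [e1, e2, he₁, ← smul_add, ← Finset.sum_add_distrib]
    congr 1
    exact Finset.sum_congr rfl fun i _ => by rw [hPw, add_smul]
  have hSr : S⁻¹ *ᵥ r = h • w - h • (S⁻¹ *ᵥ (Cpp G U *ᵥ w)) := by
    have h1 : S *ᵥ (h • w - h • (S⁻¹ *ᵥ (Cpp G U *ᵥ w))) = r := by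
      rw [Matrix.mulVec_sub, Matrix.mulVec_smul, Matrix.mulVec_smul, Matrix.mulVec_mulVec w S⁻¹,
        Matrix.mulVec_mulVec, ← Matrix.mul_assoc, Matrix.mul_nonsing_inv _ hu, Matrix.one_mul]
      rw [hSdef, Matrix.add_mulVec, Matrix.smul_mulVec, hΓw, smul_add, smul_smul, mul_inv_cancel₀ hh.ne', one_smul]
      abel
    rw [← h1, Matrix.mulVec_mulVec, Matrix.nonsing_inv_mul _ hu, Matrix.one_mulVec]
  clear_value e₁
  refine ⟨-(h • e₁) + h • (Cup G U *ᵥ (S⁻¹ *ᵥ (Cpp G U *ᵥ w))), ?_, ?_⟩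
  · have : z - aug G m = -r := by rw [hr]; abel
    rw [this, Matrix.mulVec_neg, ← Matrix.mulVec_mulVec, hSr, Matrix.mulVec_sub, Matrix.mulVec_smul,
      Matrix.mulVec_smul, hupw, smul_add]
    abel
  · refine (evNorm_add _ _).trans ?_
    rw [evNorm_neg, evNorm_smul, evNorm_smul, abs_of_pos hh]
    have f1 : evNorm (Cup G U *ᵥ (S⁻¹ *ᵥ (Cpp G U *ᵥ w))) ≤ 2 * M₁ * ρ ^ 2 * (h / γ₀) * (2 * M₁ * ρ * (ρ * evNorm g + 2 * M₂ * ρ ^ 2 * evNorm w)) := by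
      refine (hup _).trans ?_
      rw [mul_assoc (2 * M₁ * ρ ^ 2)]
      refine mul_le_mul_of_nonneg_left ((hSinv _).trans ?_) (by positivity)
      exact mul_le_mul_of_nonneg_left hpp (by positivity)
    gcongr

end meanstep

section lossfacts
variable {du dy : ℕ}

lemma jac_mulVec {a b : ℕ} (H : (Fin a → ℝ) → Fin b → ℝ) (x v : Fin a → ℝ) :
    jac H x *ᵥ v = fderiv ℝ H x v := by
  conv_rhs => rw [pi_eq_sum_univ' v]
  ext i
  simp [jac, Matrix.mulVec, dotProduct, map_sum, mul_comm]

lemma gradVec_dot {a : ℕ} (f : (Fin a → ℝ) → ℝ) (x v : Fin a → ℝ) :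
    gradVec f x ⬝ᵥ v = fderiv ℝ f x v := by
  conv_rhs => rw [pi_eq_sum_univ' v]
  simp [gradVec, dotProduct, map_sum, mul_comm]

lemma hasFDerivAt_loss (G : (Fin du → ℝ) → Fin dy → ℝ) (hreg : ContDiff ℝ 2 (aug G))
    (Γ : Matrix (Fin dy) (Fin dy) ℝ) (hΓ : Γ.PosDef) (z : Fin (dy + du) → ℝ) (y v : Fin du → ℝ) :
    DifferentiableAt ℝ (lossFn G Γ z) y ∧ fderiv ℝ (lossFn G Γ z) y v =
      2 * ((((gammaPlus Γ)⁻¹ *ᵥ (aug G y - z)) ᵥ* jac (aug G) y) ⬝ᵥ v) := by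
  have hd : HasFDerivAt (aug G) (fderiv ℝ (aug G) y) y :=
    (hreg.differentiable (by norm_num) y).hasFDerivAt
  set H' := fderiv ℝ (aug G) y with hH'
  set A := (gammaPlus (du := du) Γ)⁻¹ with hA
  have hAs : Aᵀ = A := by
    have : A.IsHermitian := (gammaPlus_posDef (du := du) Γ hΓ).inv.1
    simpa [Matrix.IsHermitian] using this
  have hf : ∀ i, HasFDerivAt (fun x => aug G x i - z i) ((ContinuousLinearMap.proj i).comp H') y :=
    fun i => (hasFDerivAt_pi'.1 hd i).sub_const (z i)
  have hm := HasFDerivAt.fun_sum (u := Finset.univ) fun i _ =>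
    (hf i).fun_mul (HasFDerivAt.fun_sum (u := Finset.univ) fun j _ => (hf j).const_mul (A i j))
  have hl : (fun x => ∑ i, (aug G x i - z i) * ∑ j, A i j * (aug G x j - z j)) = lossFn G Γ z := rfl
  replace hm : HasFDerivAt (lossFn G Γ z) _ y := hm
  refine ⟨hm.differentiableAt, ?_⟩
  rw [hm.fderiv, ← Matrix.dotProduct_mulVec, jac_mulVec, ← hH']
  have h1 : (aug G y - z) ⬝ᵥ A *ᵥ (H' v) = (A *ᵥ (aug G y - z)) ⬝ᵥ H' v := by
    rw [Matrix.dotProduct_mulVec, ← Matrix.mulVec_transpose, hAs]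
  rw [two_mul]
  nth_rewrite 1 [← h1]
  simp [dotProduct, Matrix.mulVec, Finset.sum_add_distrib, mul_comm]

lemma loss_upper (G : (Fin du → ℝ) → Fin dy → ℝ) (M₁ M₂ : ℝ) (hM₁ : 0 < M₁)
    (hLip : ∀ x x', evNorm (aug G x - aug G x') ≤ M₁ * evNorm (x - x'))
    (hTay : ∀ x x',
      evNorm (aug G x' - aug G x - (jac (aug G) x).mulVec (x' - x)) ≤ M₂ * evNorm (x' - x) ^ 2)
    (Γ : Matrix (Fin dy) (Fin dy) ℝ) (hΓ : Γ.PosDef) (cΓ : ℝ) (hcΓ : 0 ≤ cΓ)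
    (hcb : ∀ v, evNorm ((gammaPlus (du := du) Γ)⁻¹ *ᵥ v) ≤ cΓ * evNorm v)
    (z : Fin (dy + du) → ℝ) (x d : Fin du → ℝ) (w : Fin (dy + du) → ℝ) (W : ℝ)
    (hw : w = (gammaPlus Γ)⁻¹ *ᵥ (aug G x - z)) (hW : evNorm w ≤ W) :
    lossFn G Γ z (x + d) ≤ lossFn G Γ z x + 2 * ((w ᵥ* jac (aug G) x) ⬝ᵥ d) +
      (2 * W * M₂ + cΓ * M₁ ^ 2) * evNorm d ^ 2 := by
  set A := (gammaPlus (du := du) Γ)⁻¹ with hA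
  have hAs : Aᵀ = A := by
    have : A.IsHermitian := (gammaPlus_posDef (du := du) Γ hΓ).inv.1
    simpa [Matrix.IsHermitian] using this
  set r := aug G x - z with hr
  set D := aug G (x + d) - aug G x with hD
  have h0 : aug G (x + d) - z = r + D := by rw [hr, hD]; abel
  have hDb : evNorm D ≤ M₁ * evNorm d := by simpa using hLip (x + d) x
  have hT := hTay x (x + d)
  rw [add_sub_cancel_left, ← hD] at hT
  have h1 : r ⬝ᵥ A *ᵥ D = w ⬝ᵥ D := by
    rw [Matrix.dotProduct_mulVec, ← Matrix.mulVec_transpose, hAs, hw]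
  have h2 : D ⬝ᵥ A *ᵥ D ≤ cΓ * M₁ ^ 2 * evNorm d ^ 2 := by
    have hn := evNorm_nonneg d
    have hn' := evNorm_nonneg D
    calc D ⬝ᵥ A *ᵥ D ≤ evNorm D * (cΓ * evNorm D) := (dot_le _ _).trans (by gcongr; exact hcb D)
      _ ≤ (M₁ * evNorm d) * (cΓ * (M₁ * evNorm d)) := by gcongr
      _ = _ := by ring
  have h3 : w ⬝ᵥ D ≤ (w ᵥ* jac (aug G) x) ⬝ᵥ d + W * M₂ * evNorm d ^ 2 := by
    have e : D = jac (aug G) x *ᵥ d + (D - jac (aug G) x *ᵥ d) := by abel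
    rw [e, dotProduct_add, Matrix.dotProduct_mulVec]
    have : w ⬝ᵥ (D - jac (aug G) x *ᵥ d) ≤ W * (M₂ * evNorm d ^ 2) :=
      (dot_le _ _).trans (mul_le_mul hW hT (evNorm_nonneg _) ((evNorm_nonneg _).trans hW))
    linarith
  have h4 : lossFn G Γ z (x + d) = lossFn G Γ z x + 2 * (w ⬝ᵥ D) + D ⬝ᵥ A *ᵥ D := by
    unfold lossFn
    rw [h0, ← hA, ← hr, Matrix.mulVec_add, add_dotProduct, dotProduct_add, dotProduct_add, h1, ← hw,
      dotProduct_comm D w]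
    ring
  rw [h4]; linarith

end lossfacts

lemma scalar_step (a a' b q x ρ K₁ K₂ L gd dn lc : ℝ) (hb : 0 < b) (hq : 0 < q)
    (hL : 0 ≤ L) (hdn0 : 0 ≤ dn)
    (h1 : a' ≤ a + 2 * gd + L * dn ^ 2)
    (h2 : gd ≤ -(b * q * x ^ 2) + x * (K₁ * q * (ρ + q * x)))
    (h3 : dn ≤ K₂ * q * (x + ρ)) (h4 : (2 * K₁ + 2 * L * K₂ ^ 2) * q ≤ b / 4) (hq1 : q ≤ 1)
    (h5 : lc * a ≤ x ^ 2) :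
    a' ≤ (1 - 3 / 2 * b * lc * q) * a + (4 * K₁ ^ 2 / b + 2 * L * K₂ ^ 2) * q * ρ ^ 2 := by
  have e1 : dn ^ 2 ≤ K₂ ^ 2 * q ^ 2 * (2 * (x ^ 2 + ρ ^ 2)) := by
    calc dn ^ 2 ≤ (K₂ * q * (x + ρ)) ^ 2 := by gcongr
      _ = K₂ ^ 2 * q ^ 2 * (x + ρ) ^ 2 := by ring
      _ ≤ _ := by gcongr; nlinarith [sq_nonneg (x - ρ)]
  have e2 : 2 * K₁ * x * ρ ≤ b / 4 * x ^ 2 + 4 * K₁ ^ 2 / b * ρ ^ 2 := by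
    have : 0 ≤ (b / 2 * x - 2 * K₁ * ρ) ^ 2 / b := by positivity
    have h : (b / 2 * x - 2 * K₁ * ρ) ^ 2 / b =
      b / 4 * x ^ 2 + 4 * K₁ ^ 2 / b * ρ ^ 2 - 2 * K₁ * x * ρ := by field_simp; ring
    linarith
  have e3 : L * dn ^ 2 ≤ L * (K₂ ^ 2 * q ^ 2 * (2 * (x ^ 2 + ρ ^ 2))) := by gcongr
  have e4 : q * (2 * K₁ * x * ρ) ≤ q * (b / 4 * x ^ 2 + 4 * K₁ ^ 2 / b * ρ ^ 2) := by gcongr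
  have e5 : ((2 * K₁ + 2 * L * K₂ ^ 2) * q) * (q * x ^ 2) ≤ b / 4 * (q * x ^ 2) := by gcongr
  have e6 : 2 * L * K₂ ^ 2 * ρ ^ 2 * q * q ≤ 2 * L * K₂ ^ 2 * ρ ^ 2 * q * 1 := by gcongr
  have e7 : (3 / 2 * b * q) * (lc * a) ≤ (3 / 2 * b * q) * x ^ 2 := by gcongr
  nlinarith

lemma err_scalar (M₁ M₂ γ₀ h ρ W w x Q q : ℝ) (hM₁ : 0 < M₁) (hM₂ : 0 < M₂) (hγ₀ : 0 < γ₀)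
    (hρ : 0 ≤ ρ) (hw0 : 0 ≤ w) (hw : w ≤ W) (hx : 0 ≤ x) (hQ : 0 ≤ Q) (hq : 0 < q)
    (hq1 : q ≤ 1) (hh : 0 < h) (hQq : h * ρ ^ 2 = Q * q) :
    h * (2 * M₂ * ρ ^ 3 * w) +
        h * (2 * M₁ * ρ ^ 2 * (h / γ₀) * (2 * M₁ * ρ * (ρ * x + 2 * M₂ * ρ ^ 2 * w))) ≤
    (2 * Q * M₂ * W + 4 * M₁ ^ 2 / γ₀ * Q ^ 2 * (1 + 2 * M₂ * W)) * q * (ρ + q * x) := by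
  have hW : 0 ≤ W := hw0.trans hw
  have e : h * (2 * M₂ * ρ ^ 3 * w) +
        h * (2 * M₁ * ρ ^ 2 * (h / γ₀) * (2 * M₁ * ρ * (ρ * x + 2 * M₂ * ρ ^ 2 * w))) =
      2 * (h * ρ ^ 2) * M₂ * w * ρ + 4 * M₁ ^ 2 / γ₀ * (h * ρ ^ 2) ^ 2 * (x + 2 * M₂ * w * ρ) := by
    ring
  rw [e, hQq]
  have f1 : 2 * (Q * q) * M₂ * w * ρ ≤ 2 * (Q * q) * M₂ * W * (ρ + q * x) := by
    gcongr; nlinarith [mul_nonneg hq.le hx]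
  have f2 : q * (x + 2 * M₂ * w * ρ) ≤ (1 + 2 * M₂ * W) * (ρ + q * x) := by
    have g1 : q * (2 * M₂ * w * ρ) ≤ 1 * (2 * M₂ * W * ρ) := by gcongr
    have : 0 ≤ 2 * M₂ * W * (q * x) := by positivity
    nlinarith
  have f3 : 4 * M₁ ^ 2 / γ₀ * Q ^ 2 * q * (q * (x + 2 * M₂ * w * ρ)) ≤
      4 * M₁ ^ 2 / γ₀ * Q ^ 2 * q * ((1 + 2 * M₂ * W) * (ρ + q * x)) := by gcongr
  nlinarith

lemma tendsto_q (γ : ℝ) (hγ : γ < 1) :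
    Filter.Tendsto (fun n : ℕ => (n:ℝ) ^ (γ - 1)) Filter.atTop (nhds 0) := by
  have := (tendsto_rpow_neg_atTop (show 0 < 1 - γ by linarith)).comp tendsto_natCast_atTop_atTop
  simpa [Function.comp_def] using this

lemma eventually_small (γ : ℝ) (hγ : γ < 1) (c ε : ℝ) (hε : 0 < ε) :
    ∃ n₁ : ℕ, ∀ n : ℕ, n₁ ≤ n → c * (n:ℝ) ^ (γ - 1) ≤ ε := by
  have h := (tendsto_q γ hγ).const_mul c
  rw [mul_zero] at h
  exact Filter.eventually_atTop.1 (h.eventually_le_const hε)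

set_option maxHeartbeats 4000000 in
lemma main_recursion
    {du dy K : ℕ}
    (G : (Fin du → ℝ) → Fin dy → ℝ)
    (M₁ M₂ : ℝ) (hM₁ : 0 < M₁) (hM₂ : 0 < M₂)
    (hreg : ContDiff ℝ 2 (aug G))
    (hLip : ∀ x x', evNorm (aug G x - aug G x') ≤ M₁ * evNorm (x - x'))
    (hTay : ∀ x x',
      evNorm (aug G x' - aug G x - (jac (aug G) x).mulVec (x' - x)) ≤ M₂ * evNorm (x' - x) ^ 2)
    (Γ : Matrix (Fin dy) (Fin dy) ℝ) (hΓ : Γ.PosDef)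
    (z : Fin (dy + du) → ℝ)
    (h₀ α₀ γ β : ℝ) (hh₀ : 0 < h₀)
    (hγ0 : 0 ≤ γ) (hγ1 : γ < 1) (hβu : β ≤ γ)
    (u : ℕ → Fin K → Fin du → ℝ)
    (hmean : ∀ n : ℕ, 1 ≤ n →
      sMean (u (n + 1)) = sMean (u n) +
        (Cup G (u n) *
          (Cpp G (u n) + (h₀ * (n : ℝ) ^ β)⁻¹ • gammaPlus Γ)⁻¹).mulVec
            (z - aug G (sMean (u n))))
    (hcov : ∀ n : ℕ, 1 ≤ n →
      Cuu (u (n + 1)) = Cuu (u n) -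
        Cup G (u n) * (Cpp G (u n) + (h₀ * (n : ℝ) ^ β)⁻¹ • gammaPlus Γ)⁻¹ * (Cup G (u n))ᵀ +
        (α₀ ^ 2 * h₀⁻¹ * (n : ℝ) ^ (2 * γ - β - 2)) • 1)
    (hbdd : ∃ B : ℝ, ∀ n : ℕ, evNorm (sMean (u n)) ≤ B)
    (κm : ℝ) (hκm : 0 < κm)
    (hCl : ∀ n : ℕ, 1 ≤ n →
      loewnerLE ((κm * (n : ℝ) ^ (γ - β - 1)) • 1) (Cuu (u n)))
    (lc : ℝ) (hlc : 0 < lc)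
    (hconv : ∀ x y : Fin du → ℝ,
      lossFn G Γ z x - lossFn G Γ z y ≥
        gradVec (lossFn G Γ z) y ⬝ᵥ (x - y) + lc * evNorm (x - y) ^ 2)
    (ustar : Fin du → ℝ) :
    ∃ C : ℝ, 0 ≤ C ∧ ∃ n₁ : ℕ, 1 ≤ n₁ ∧ ∀ n : ℕ, n₁ ≤ n →
      lossFn G Γ z (sMean (u (n + 1))) - lossFn G Γ z ustar ≤
        (1 - 3 / 2 * (h₀ * κm) * lc * (n:ℝ) ^ (γ - 1)) *
          (lossFn G Γ z (sMean (u n)) - lossFn G Γ z ustar) +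
        C * (n:ℝ) ^ (γ - 1) * (n:ℝ) ^ (-(1 + β - γ)) := by
  obtain ⟨c₁, hc₁⟩ := sCov_upper (u 1)
  obtain ⟨A, hA, hAb⟩ := cov_upper (fun n => Cuu (u n)) h₀ α₀ γ β hh₀ hγ0 hγ1.le hβu c₁ hc₁ (by
    intro n hn v t
    have hn0 : (0:ℝ) < n := by exact_mod_cast hn
    have := cov_step_quad G Γ hΓ (u n) (h₀ * (n : ℝ) ^ β)⁻¹ (by positivity) v t
    simp only [hcov n hn]
    rw [Matrix.add_mulVec, dotProduct_add, Matrix.smul_mulVec, dotProduct_smul, Matrix.one_mulVec, ← evNorm_sq, smul_eq_mul]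
    linarith)
  obtain ⟨γ₀, hγ₀, hγ₀b⟩ := exists_quad_lower _ (gammaPlus_posDef (du := du) Γ hΓ)
  obtain ⟨cΓ, hcΓ, hcΓb⟩ := exists_mulVec_bound (gammaPlus (du := du) Γ)⁻¹
  obtain ⟨B, hB⟩ := hbdd
  set W := cΓ * (M₁ * B + evNorm (aug G 0 - z)) with hW
  have hWb : ∀ n, evNorm ((gammaPlus Γ)⁻¹ *ᵥ (aug G (sMean (u n)) - z)) ≤ W := by
    intro n
    refine (hcΓb _).trans ?_
    rw [hW]
    gcongr
    have e : aug G (sMean (u n)) - z = (aug G (sMean (u n)) - aug G 0) + (aug G 0 - z) := by abel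
    rw [e]
    refine (evNorm_add _ _).trans ?_
    gcongr
    refine (hLip _ _).trans ?_
    rw [sub_zero]
    have := hB n
    gcongr
  have hW0 : 0 ≤ W := (evNorm_nonneg _).trans (hWb 0)
  set Q := h₀ * (K * A) with hQ
  have hQ0 : 0 ≤ Q := by positivity
  set K₁ := 2 * Q * M₂ * W + 4 * M₁ ^ 2 / γ₀ * Q ^ 2 * (1 + 2 * M₂ * W) with hK₁
  have hK₁0 : 0 ≤ K₁ := by positivity
  set L := 2 * W * M₂ + cΓ * M₁ ^ 2 with hL
  have hL0 : 0 ≤ L := by positivity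
  set b := h₀ * κm with hb
  have hb0 : 0 < b := by positivity
  obtain ⟨n₁, hn₁⟩ := eventually_small γ hγ1 (2 * K₁ + 2 * L * (Q + K₁) ^ 2) (b / 4) (by positivity)
  refine ⟨(4 * K₁ ^ 2 / b + 2 * L * (Q + K₁) ^ 2) * (K * A), by positivity, max n₁ 1, le_max_right _ _,
    fun n hn => ?_⟩
  have hn1' : 1 ≤ n := (le_max_right _ _).trans hn
  have hsmall := hn₁ n ((le_max_left _ _).trans hn)
  have hn1 : (1:ℝ) ≤ n := by exact_mod_cast hn1'
  have hn0 : (0:ℝ) < n := by linarith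
  set q := (n:ℝ) ^ (γ - 1) with hq
  have hqpos : 0 < q := by positivity
  have hq1 : q ≤ 1 := Real.rpow_le_one_of_one_le_of_nonpos hn1 (by linarith)
  set X := (n:ℝ) ^ (-(1 + β - γ)) with hX
  have hXpos : 0 < X := by positivity
  have hBX : (n:ℝ) ^ β * X = q := by
    rw [hX, ← Real.rpow_add hn0]; congr 1; ring
  set h := h₀ * (n:ℝ) ^ β with hh
  have hhpos : 0 < h := by positivity
  set ρ := Real.sqrt (K * (A * X)) with hρ
  have hρ0 : 0 ≤ ρ := Real.sqrt_nonneg _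
  have hρ2 : ρ ^ 2 = K * A * X := by rw [hρ, Real.sq_sqrt (by positivity)]; ring
  have hQq : h * ρ ^ 2 = Q * q := by rw [hρ2, hh, hQ, ← hBX]; ring
  have hdev := dev_bound (u n) (A * X) (by positivity) (hAb n hn1')
  set m := sMean (u n) with hm
  obtain ⟨w, hw⟩ : ∃ w, w = (gammaPlus Γ)⁻¹ *ᵥ (aug G m - z) := ⟨_, rfl⟩
  obtain ⟨g, hg⟩ : ∃ g, g = w ᵥ* jac (aug G) m := ⟨_, rfl⟩
  have hwW : evNorm w ≤ W := hw ▸ hWb n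
  obtain ⟨hCg, e, he, heb⟩ := mean_step G M₁ M₂ hM₁ hM₂ hLip hTay Γ hΓ γ₀ hγ₀ hγ₀b (u n) h ρ hhpos hρ0
    hdev z _ w g rfl hw hg
  have heb' : evNorm e ≤ K₁ * q * (ρ + q * evNorm g) :=
    heb.trans (err_scalar M₁ M₂ γ₀ h ρ W (evNorm w) (evNorm g) Q q hM₁ hM₂ hγ₀ hρ0 (evNorm_nonneg _)
      hwW (evNorm_nonneg _) hQ0 hqpos hq1 hhpos hQq)
  have hng := evNorm_nonneg g
  set d := -(h • Cuu (u n) *ᵥ g) + e with hd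
  have hstep : sMean (u (n + 1)) = m + d := by rw [hmean n hn1', ← he]
  have hup := loss_upper G M₁ M₂ hM₁ hLip hTay Γ hΓ cΓ hcΓ hcΓb z m d w W hw hwW
  rw [← hg, ← hstep] at hup
  -- lower bound on the covariance
  have hlow : κm * (n:ℝ) ^ (γ - β - 1) * evNorm g ^ 2 ≤ g ⬝ᵥ Cuu (u n) *ᵥ g := by
    have := (hCl n hn1').dotProduct_mulVec_nonneg g
    simp only [star_trivial] at this
    rw [Matrix.sub_mulVec, dotProduct_sub, Matrix.smul_mulVec, dotProduct_smul, Matrix.one_mulVec, ← evNorm_sq, smul_eq_mul] at this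
    linarith
  have hXe : (n:ℝ) ^ (γ - β - 1) = X := by rw [hX]; congr 1; ring
  rw [hXe] at hlow
  have hgd : g ⬝ᵥ d ≤ -(b * q * evNorm g ^ 2) + evNorm g * (K₁ * q * (ρ + q * evNorm g)) := by
    rw [hd, dotProduct_add, dotProduct_neg, dotProduct_smul, smul_eq_mul]
    have f1 : h * (κm * X * evNorm g ^ 2) ≤ h * (g ⬝ᵥ Cuu (u n) *ᵥ g) := by gcongr
    have f2 : h * (κm * X * evNorm g ^ 2) = b * q * evNorm g ^ 2 := by rw [hh, hb, ← hBX]; ring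
    have f3 : g ⬝ᵥ e ≤ evNorm g * (K₁ * q * (ρ + q * evNorm g)) := (dot_le _ _).trans (by gcongr)
    linarith
  have hdn : evNorm d ≤ (Q + K₁) * q * (evNorm g + ρ) := by
    rw [hd]
    refine (evNorm_add _ _).trans ?_
    rw [evNorm_neg, evNorm_smul, abs_of_pos hhpos]
    have f1 : h * evNorm (Cuu (u n) *ᵥ g) ≤ Q * q * evNorm g := by
      exact (mul_le_mul_of_nonneg_left hCg hhpos.le).trans_eq (by rw [← hQq]; ring)
    have f2 : K₁ * q * (ρ + q * evNorm g) ≤ K₁ * q * (ρ + 1 * evNorm g) := by gcongr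
    have f3 : 0 ≤ Q * q * ρ := by positivity
    nlinarith
  have hPL : lc * (lossFn G Γ z m - lossFn G Γ z ustar) ≤ evNorm g ^ 2 := by
    have h1 := hconv ustar m
    rw [gradVec_dot, (hasFDerivAt_loss G hreg Γ hΓ z m (ustar - m)).2, ← hw, ← hg] at h1
    have h2 := (abs_le.1 (abs_dot_le g (ustar - m))).1
    have h3 : 0 ≤ (lc * evNorm (ustar - m) - evNorm g) ^ 2 := sq_nonneg _
    nlinarith
  have := scalar_step (lossFn G Γ z m - lossFn G Γ z ustar) (lossFn G Γ z (sMean (u (n + 1))) - lossFn G Γ z ustar)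
    b q (evNorm g) ρ K₁ (Q + K₁) L (g ⬝ᵥ d) (evNorm d) lc hb0 hqpos hL0 (evNorm_nonneg _)
    (by linarith) hgd hdn hsmall hq1 hPL
  rw [hρ2] at this
  refine this.trans (le_of_eq ?_)
  ring

lemma exists_rate (a : ℕ → ℝ) (p C γ s α : ℝ) (hγ0 : 0 ≤ γ) (hγ : γ < 1) (hp : 0 < p) (hC : 0 ≤ C)
    (hα : 0 ≤ α) (hαs : α ≤ s) (hαp : γ = 0 → α < p) (n₁ : ℕ) (hn₁ : 1 ≤ n₁)
    (hrec : ∀ n : ℕ, n₁ ≤ n → a (n + 1) ≤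
      (1 - p * (n:ℝ) ^ (γ - 1)) * a n + C * (n:ℝ) ^ (γ - 1) * (n:ℝ) ^ (-s)) :
    ∃ n₀ : ℕ, 1 ≤ n₀ ∧ ∃ D : ℝ, 0 ≤ D ∧ ∀ N : ℕ, n₀ ≤ N → a N ≤ D * (N:ℝ) ^ (-α) := by
  obtain ⟨n₂, hn₂⟩ := eventually_small γ hγ p 1 one_pos
  obtain ⟨p', hp', n₃, hn₃⟩ : ∃ p' : ℝ, 0 < p' ∧ ∃ n₃ : ℕ, ∀ n : ℕ, n₃ ≤ n → 1 ≤ n →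
      p' * (n:ℝ) ^ (γ - 1) ≤ p * (n:ℝ) ^ (γ - 1) - α / n := by
    rcases hγ0.eq_or_lt with h0 | h0
    · refine ⟨p - α, by linarith [hαp h0.symm], 1, fun n _ hn => ?_⟩
      rw [← h0, zero_sub, Real.rpow_neg_one]
      apply le_of_eq; ring
    · obtain ⟨n₃, hn₃⟩ := eventually_small (1 - γ) (by linarith) α (p / 2) (by positivity)
      refine ⟨p / 2, by positivity, n₃, fun n hn hn1 => ?_⟩
      have hn0 : (0:ℝ) < n := by exact_mod_cast hn1
      have h1 := hn₃ n hn
      have h2 : α / n = (α * (n:ℝ) ^ (1 - γ - 1)) * (n:ℝ) ^ (γ - 1) := by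
        rw [mul_assoc, ← Real.rpow_add hn0, div_eq_mul_inv, ← Real.rpow_neg_one]
        congr 2; ring
      have hq : 0 < (n:ℝ) ^ (γ - 1) := by positivity
      rw [h2]
      nlinarith
  refine ⟨max n₁ (max n₂ n₃), hn₁.trans (le_max_left _ _), ?_⟩
  have l1 : ∀ n, max n₁ (max n₂ n₃) ≤ n → n₁ ≤ n ∧ n₂ ≤ n ∧ n₃ ≤ n := fun n hn => by omega
  exact rec_bound a p p' C γ s α hC hp' hα hαs _ (hn₁.trans (le_max_left _ _))
    (fun n hn => by linarith [hn₂ n (l1 n hn).2.1])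
    (fun n hn => hn₃ n (l1 n hn).2.2 (hn₁.trans (l1 n hn).1))
    (fun n hn => hrec n (l1 n hn).1)


/-- Theorem: polynomial convergence of EKI to the global minimizer under
strong convexity of the regularized loss. -/
theorem eki_strongly_convex_convergence
    {du dy K : ℕ}
    (G : (Fin du → ℝ) → Fin dy → ℝ)
    (M₁ M₂ : ℝ) (hM₁ : 0 < M₁) (hM₂ : 0 < M₂)
    (hreg : ContDiff ℝ 2 (aug G))
    (hJ : ∀ x, spNorm (jac (aug G) x) ≤ M₁)
    (hLip : ∀ x x', evNorm (aug G x - aug G x') ≤ M₁ * evNorm (x - x'))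
    (hTay : ∀ x x',
      evNorm (aug G x' - aug G x - (jac (aug G) x).mulVec (x' - x)) ≤ M₂ * evNorm (x' - x) ^ 2)
    (Γ : Matrix (Fin dy) (Fin dy) ℝ) (hΓ : Γ.PosDef)
    (z : Fin (dy + du) → ℝ)
    (h₀ α₀ γ β : ℝ) (hh₀ : 0 < h₀) (hα₀ : 0 < α₀)
    (hγ0 : 0 ≤ γ) (hγ1 : γ ≤ 1) (hβl : γ - 1 ≤ β) (hβu : β ≤ γ)
    (u : ℕ → Fin K → Fin du → ℝ)
    (hC1 : (Cuu (u 1)).PosDef)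
    (hmean : ∀ n : ℕ, 1 ≤ n →
      sMean (u (n + 1)) = sMean (u n) +
        (Cup G (u n) *
          (Cpp G (u n) + (h₀ * (n : ℝ) ^ β)⁻¹ • gammaPlus Γ)⁻¹).mulVec
            (z - aug G (sMean (u n))))
    (hcov : ∀ n : ℕ, 1 ≤ n →
      Cuu (u (n + 1)) = Cuu (u n) -
        Cup G (u n) * (Cpp G (u n) + (h₀ * (n : ℝ) ^ β)⁻¹ • gammaPlus Γ)⁻¹ * (Cup G (u n))ᵀ +
        (α₀ ^ 2 * h₀⁻¹ * (n : ℝ) ^ (2 * γ - β - 2)) • 1)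
    (hbdd : ∃ B : ℝ, ∀ n : ℕ, evNorm (sMean (u n)) ≤ B)
    (κm : ℝ) (hκm : 0 < κm)
    (hCl : ∀ n : ℕ, 1 ≤ n →
      loewnerLE ((κm * (n : ℝ) ^ (γ - β - 1)) • 1) (Cuu (u n)))
    (lc : ℝ) (hlc : 0 < lc)
    (hconv : ∀ x y : Fin du → ℝ,
      lossFn G Γ z x - lossFn G Γ z y ≥
        gradVec (lossFn G Γ z) y ⬝ᵥ (x - y) + lc * evNorm (x - y) ^ 2)
    (ustar : Fin du → ℝ) (hustar : ∀ x : Fin du → ℝ, lossFn G Γ z ustar ≤ lossFn G Γ z x) :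
    ∃ n₀ : ℕ, ∃ D : ℝ, ∀ N : ℕ, n₀ ≤ N →
      (γ = 0 → ∀ α : ℝ, α < min ((1 + β) / 2) (h₀ * κm * lc) →
        lc * evNorm (sMean (u N) - ustar) ^ 2 ≤ lossFn G Γ z (sMean (u N)) - lossFn G Γ z ustar ∧
        lossFn G Γ z (sMean (u N)) - lossFn G Γ z ustar ≤ D * (N : ℝ) ^ (-α)) ∧
      (0 < γ → γ < 1 → ∀ α : ℝ, α < (1 + β - γ) / 2 →
        lc * evNorm (sMean (u N) - ustar) ^ 2 ≤ lossFn G Γ z (sMean (u N)) - lossFn G Γ z ustar ∧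
        lossFn G Γ z (sMean (u N)) - lossFn G Γ z ustar ≤ D * (N : ℝ) ^ (-α)) := by
  have hlow : ∀ x, lc * evNorm (x - ustar) ^ 2 ≤ lossFn G Γ z x - lossFn G Γ z ustar := by
    intro x
    have h1 := hconv x ustar
    have hmin : IsLocalMin (lossFn G Γ z) ustar := Filter.Eventually.of_forall hustar
    rw [gradVec_dot, hmin.fderiv_eq_zero] at h1
    simpa using h1
  rcases hγ1.eq_or_lt with hγe | hγlt
  · exact ⟨0, 0, fun N _ => ⟨fun h => by linarith, fun _ h => by linarith⟩⟩
  obtain ⟨C, hC, n₁, hn₁, hrec⟩ := main_recursion G M₁ M₂ hM₁ hM₂ hreg hLip hTay Γ hΓ z h₀ α₀ γ β hh₀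
    hγ0 hγlt hβu u hmean hcov hbdd κm hκm hCl lc hlc hconv ustar
  have hp : 0 < 3 / 2 * (h₀ * κm) * lc := by positivity
  set αs : ℝ := if γ = 0 then min ((1 + β) / 2) (h₀ * κm * lc) else (1 + β - γ) / 2 with hαs
  have hk : 0 < h₀ * κm * lc := by positivity
  have hαs0 : 0 ≤ αs := by
    rw [hαs]; split_ifs with h
    · exact le_min (by linarith) hk.le
    · linarith
  have hαs1 : αs ≤ 1 + β - γ := by
    rw [hαs]; split_ifs with h
    · exact (min_le_left _ _).trans (by linarith)
    · linarith
  have hαp : γ = 0 → αs < 3 / 2 * (h₀ * κm) * lc := by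
    intro h
    rw [hαs, if_pos h]
    exact lt_of_le_of_lt (min_le_right _ _) (by nlinarith)
  obtain ⟨n₀, hn₀, D, hD, hfin⟩ := exists_rate
    (fun n => lossFn G Γ z (sMean (u n)) - lossFn G Γ z ustar) (3 / 2 * (h₀ * κm) * lc) C γ
    (1 + β - γ) αs hγ0 hγlt hp hC hαs0 hαs1 hαp n₁ hn₁ hrec
  refine ⟨n₀, D, fun N hN => ?_⟩
  have hN1 : (1:ℝ) ≤ N := by exact_mod_cast hn₀.trans hN
  have key : ∀ α : ℝ, α < αs →
      lossFn G Γ z (sMean (u N)) - lossFn G Γ z ustar ≤ D * (N : ℝ) ^ (-α) := fun α hα =>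
    (hfin N hN).trans (mul_le_mul_of_nonneg_left
      (Real.rpow_le_rpow_of_exponent_le hN1 (by linarith)) hD)
  refine ⟨fun h0 α hα => ⟨hlow _, key α ?_⟩, fun h0 _ α hα => ⟨hlow _, key α ?_⟩⟩
  · rw [hαs, if_pos h0]; exact hα
  · rw [hαs, if_neg h0.ne']; exact hα
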